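/- arXiv:0711.4452 — 7 statements merged into one kernel-verified Lean document; each statement's English description precedes it below -/
import Mathlib

section
/- Let n ≥ 1 and let A be a real n×n matrix admitting a singular value decomposition A = U * D * Vᵀ, where U and V are n×n orthogonal matrices (U * Uᵀ = 1 and V * Vᵀ = 1) and D is a diagonal n×n matrix with nonnegative diagonal entries. Then for every n×n orthogonal matrix L (L * Lᵀ = 1), trace(A * Lᵀ) ≤ trace(D). -/
open Matrix

/-- If `A = U * D * Vᵀ` is a singular value decomposition of the real
`n × n` matrix `A` (with `U`, `V` orthogonal and `D` diagonal with nonnegative diagonal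
entries), then for every orthogonal matrix `L` we have `trace (A * Lᵀ) ≤ trace D`. -/
theorem svd_trace_mul_orthogonal_le_trace_diag
    (n : ℕ) (hn : 1 ≤ n) (A U D V : Matrix (Fin n) (Fin n) ℝ)
    (hU : U * Uᵀ = 1) (hV : V * Vᵀ = 1)
    (hDdiag : ∀ i j : Fin n, i ≠ j → D i j = 0)
    (hDnonneg : ∀ i : Fin n, 0 ≤ D i i)
    (hA : A = U * D * Vᵀ) :
    ∀ L : Matrix (Fin n) (Fin n) ℝ, L * Lᵀ = 1 →
      Matrix.trace (A * Lᵀ) ≤ Matrix.trace D := by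
  intro L hL
  have hV' : Vᵀ * V = 1 := mul_eq_one_comm.mp hV
  have hL' : Lᵀ * L = 1 := mul_eq_one_comm.mp hL
  obtain ⟨W, hW⟩ : ∃ W, W = Vᵀ * Lᵀ * U := ⟨_, rfl⟩
  have hWW : W * Wᵀ = 1 := by
    have h : W * Wᵀ = Vᵀ * (Lᵀ * (U * Uᵀ) * L) * V := by
      rw [hW]
      simp only [Matrix.transpose_mul, Matrix.transpose_transpose, Matrix.mul_assoc]
    rw [h, hU, Matrix.mul_one, hL', Matrix.mul_one, hV']
  have htr : Matrix.trace (A * Lᵀ) = Matrix.trace (D * W) := by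
    rw [hA, hW, Matrix.mul_assoc, Matrix.mul_assoc, Matrix.trace_mul_comm]
    simp only [Matrix.mul_assoc]
  have hWle : ∀ i, W i i ≤ 1 := by
    intro i
    have h1 : ∑ k, W i k * W i k = 1 := by
      have h := congrFun (congrFun hWW i) i
      simpa [Matrix.mul_apply] using h
    have h2 : W i i * W i i ≤ ∑ k, W i k * W i k :=
      Finset.single_le_sum (f := fun k => W i k * W i k)
        (fun k _ => mul_self_nonneg (W i k)) (Finset.mem_univ i)
    nlinarith
  rw [htr]
  simp only [Matrix.trace, Matrix.diag_apply]
  refine Finset.sum_le_sum fun i _ => ?_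
  have h3 : (D * W) i i = D i i * W i i := by
    rw [Matrix.mul_apply]
    refine Finset.sum_eq_single i (fun j _ hj => ?_) (fun h => absurd (Finset.mem_univ i) h)
    rw [hDdiag i j hj.symm, zero_mul]
  rw [h3]
  exact mul_le_of_le_one_right (hDnonneg i) (hWle i)
end

section
/- Let A be a real n×n matrix with singular value decomposition A = U * D * Vᵀ, where U and V are orthogonal and D is diagonal with nonnegative diagonal entries. Then trace(D) is the greatest element of the set { trace(A * Lᵀ) | L an n×n orthogonal matrix }; that is, trace(D) is attained (at L = U * Vᵀ) and bounds trace(A * Lᵀ) for every orthogonal L. -/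
open Matrix

/-- If `A = U * D * Vᵀ` is a singular value decomposition of the real
`n × n` matrix `A`, then `trace D` is the greatest element of the set of the values
`trace (A * Lᵀ)` as `L` ranges over the orthogonal matrices. -/
theorem svd_trace_isGreatest
    (n : ℕ) (A U D V : Matrix (Fin n) (Fin n) ℝ)
    (hU : U * Uᵀ = 1) (hV : V * Vᵀ = 1)
    (hDdiag : ∀ i j : Fin n, i ≠ j → D i j = 0)
    (hDnonneg : ∀ i : Fin n, 0 ≤ D i i)
    (hA : A = U * D * Vᵀ) :
    IsGreatest {t : ℝ | ∃ L : Matrix (Fin n) (Fin n) ℝ,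
        L * Lᵀ = 1 ∧ t = Matrix.trace (A * Lᵀ)}
      (Matrix.trace D) := by
  have hU' : Uᵀ * U = 1 := mul_eq_one_comm.mp hU
  have hV' : Vᵀ * V = 1 := mul_eq_one_comm.mp hV
  subst hA
  constructor
  · refine ⟨U * Vᵀ, ?_, ?_⟩
    · calc U * Vᵀ * (U * Vᵀ)ᵀ = U * (Vᵀ * V) * Uᵀ := by
            simp only [transpose_mul, transpose_transpose, Matrix.mul_assoc]
        _ = 1 := by rw [hV', Matrix.mul_one, hU]
    · have h : U * D * Vᵀ * (U * Vᵀ)ᵀ = U * D * (Vᵀ * V) * Uᵀ := by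
        simp only [transpose_mul, transpose_transpose, Matrix.mul_assoc]
      rw [h, hV', Matrix.mul_one, Matrix.trace_mul_comm, ← Matrix.mul_assoc, hU',
        Matrix.one_mul]
  · rintro t ⟨L, hL, rfl⟩
    have hL' : Lᵀ * L = 1 := mul_eq_one_comm.mp hL
    obtain ⟨W, hWdef⟩ : ∃ W, W = Vᵀ * Lᵀ * U := ⟨_, rfl⟩
    have hW : W * Wᵀ = 1 := by
      calc W * Wᵀ = Vᵀ * (Lᵀ * (U * Uᵀ) * L) * V := by
            simp only [hWdef, transpose_mul, transpose_transpose, Matrix.mul_assoc]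
        _ = 1 := by rw [hU, Matrix.mul_one, hL', Matrix.mul_one, hV']
    have hle : ∀ i, W i i ≤ 1 := by
      intro i
      have h1 : ∑ j, W i j * W i j = 1 := by
        have := congrFun (congrFun hW i) i
        simpa [Matrix.mul_apply] using this
      have h2 : W i i * W i i ≤ ∑ j, W i j * W i j :=
        Finset.single_le_sum (f := fun j => W i j * W i j)
          (fun j _ => mul_self_nonneg _) (Finset.mem_univ i)
      nlinarith [sq_nonneg (W i i - 1)]
    have htr : Matrix.trace (U * D * Vᵀ * Lᵀ) = Matrix.trace (D * W) := by
      rw [hWdef, Matrix.mul_assoc, Matrix.mul_assoc, Matrix.trace_mul_comm]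
      simp only [Matrix.mul_assoc]
    rw [htr, Matrix.trace, Matrix.trace]
    apply Finset.sum_le_sum
    intro i _
    have h3 : (D * W) i i = D i i * W i i := by
      rw [Matrix.mul_apply]
      apply Finset.sum_eq_single i
      · intro j _ hj
        rw [hDdiag i j hj.symm, zero_mul]
      · simp
    rw [Matrix.diag_apply, Matrix.diag_apply, h3]
    exact mul_le_of_le_one_right (hDnonneg i) (hle i)
end

section
/- Let A be a real n×n matrix with singular value decomposition A = U * D * Vᵀ, where U and V are orthogonal and D is diagonal with nonnegative diagonal entries. Then L₀ = U * Vᵀ solves the stationarity equations of Theorem 1: A * L₀ᵀ = (A * L₀ᵀ)ᵀ (i.e., A * L₀ᵀ is symmetric) and L₀ * L₀ᵀ = 1. -/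
open Matrix

/-- If `A = U * D * Vᵀ` is a singular value decomposition of the real
`n × n` matrix `A`, then `L₀ = U * Vᵀ` solves the stationarity equations of Theorem 1:
`A * L₀ᵀ` is symmetric and `L₀ * L₀ᵀ = 1`. -/
theorem svd_UVt_solves_stationarity_equations
    (n : ℕ) (A U D V : Matrix (Fin n) (Fin n) ℝ)
    (hU : U * Uᵀ = 1) (hV : V * Vᵀ = 1)
    (hDdiag : ∀ i j : Fin n, i ≠ j → D i j = 0)
    (hDnonneg : ∀ i : Fin n, 0 ≤ D i i)
    (hA : A = U * D * Vᵀ) :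
    A * (U * Vᵀ)ᵀ = (A * (U * Vᵀ)ᵀ)ᵀ ∧ (U * Vᵀ) * (U * Vᵀ)ᵀ = 1 := by
  have hV' : Vᵀ * V = 1 := mul_eq_one_comm.mp hV
  have hD : Dᵀ = D := by
    ext i j
    rw [Matrix.transpose_apply]
    by_cases h : i = j
    · rw [h]
    · rw [hDdiag i j h, hDdiag j i (Ne.symm h)]
  have hL : (U * Vᵀ)ᵀ = V * Uᵀ := by
    rw [Matrix.transpose_mul, Matrix.transpose_transpose]
  have key : A * (U * Vᵀ)ᵀ = U * D * Uᵀ := by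
    rw [hL, hA, Matrix.mul_assoc (U * D), ← Matrix.mul_assoc Vᵀ, hV', Matrix.one_mul]
  constructor
  · rw [key, Matrix.transpose_mul, Matrix.transpose_mul, Matrix.transpose_transpose, hD,
      Matrix.mul_assoc]
  · rw [hL, Matrix.mul_assoc, ← Matrix.mul_assoc Vᵀ, hV', Matrix.one_mul, hU]
end

section
/- Let A be a real n×n matrix with singular value decomposition A = U * D * Vᵀ, where U and V are orthogonal and D is diagonal with nonnegative diagonal entries. If L₀ is an orthogonal matrix that maximizes trace(A * Lᵀ) over all orthogonal matrices L (i.e., trace(A * Lᵀ) ≤ trace(A * L₀ᵀ) for every orthogonal L), then A * L₀ᵀ is symmetric: A * L₀ᵀ = (A * L₀ᵀ)ᵀ. -/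
open Matrix

/-- If `A = U * D * Vᵀ` is a singular value decomposition of the real
`n × n` matrix `A` and `L₀` is an orthogonal matrix maximizing `trace (A * Lᵀ)` over all
orthogonal matrices `L`, then `A * L₀ᵀ` is symmetric. -/
theorem maximizer_satisfies_symmetry_equation
    (n : ℕ) (A U D V : Matrix (Fin n) (Fin n) ℝ)
    (hU : U * Uᵀ = 1) (hV : V * Vᵀ = 1)
    (hDdiag : ∀ i j : Fin n, i ≠ j → D i j = 0)
    (hDnonneg : ∀ i : Fin n, 0 ≤ D i i)
    (hA : A = U * D * Vᵀ)
    (L₀ : Matrix (Fin n) (Fin n) ℝ) (hL₀ : L₀ * L₀ᵀ = 1)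
    (hmax : ∀ L : Matrix (Fin n) (Fin n) ℝ, L * Lᵀ = 1 →
      Matrix.trace (A * Lᵀ) ≤ Matrix.trace (A * L₀ᵀ)) :
    A * L₀ᵀ = (A * L₀ᵀ)ᵀ := by
  have hU' : Uᵀ * U = 1 := mul_eq_one_comm.mp hU
  have hV' : Vᵀ * V = 1 := mul_eq_one_comm.mp hV
  have hL' : L₀ᵀ * L₀ = 1 := mul_eq_one_comm.mp hL₀
  obtain ⟨W, hW⟩ : ∃ W, W = Uᵀ * L₀ * V := ⟨_, rfl⟩
  have hWW : Wᵀ * W = 1 := by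
    calc Wᵀ * W = Vᵀ * (L₀ᵀ * (U * Uᵀ) * L₀) * V := by
          rw [hW]; simp only [transpose_mul, transpose_transpose, Matrix.mul_assoc]
      _ = 1 := by rw [hU, Matrix.mul_one, hL', Matrix.mul_one, hV']
  have hAL : A * L₀ᵀ = U * (D * Wᵀ) * Uᵀ := by
    calc A * L₀ᵀ = U * D * Vᵀ * L₀ᵀ * (U * Uᵀ) := by rw [hU, Matrix.mul_one, hA]
      _ = U * (D * Wᵀ) * Uᵀ := by
          rw [hW]; simp only [transpose_mul, transpose_transpose, Matrix.mul_assoc]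
  have hDd : D = Matrix.diagonal (fun i => D i i) := by
    ext i j
    by_cases h : i = j
    · subst h; simp
    · rw [hDdiag i j h, Matrix.diagonal_apply_ne _ h]
  have hentry : ∀ i j, (D * Wᵀ) i j = D i i * W j i := by
    intro i j
    conv_lhs => rw [hDd]
    rw [Matrix.diagonal_mul, Matrix.transpose_apply]
  have htr : Matrix.trace D ≤ Matrix.trace (D * Wᵀ) := by
    have h := hmax (U * Vᵀ) (by
      calc U * Vᵀ * (U * Vᵀ)ᵀ = U * (Vᵀ * V) * Uᵀ := by
            simp only [transpose_mul, transpose_transpose, Matrix.mul_assoc]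
        _ = 1 := by rw [hV', Matrix.mul_one, hU])
    have h1 : A * (U * Vᵀ)ᵀ = U * D * Uᵀ := by
      calc A * (U * Vᵀ)ᵀ = U * D * (Vᵀ * V) * Uᵀ := by
            rw [hA]; simp only [transpose_mul, transpose_transpose, Matrix.mul_assoc]
        _ = U * D * Uᵀ := by rw [hV', Matrix.mul_one]
    have h2 : ∀ X : Matrix (Fin n) (Fin n) ℝ, Matrix.trace (U * X * Uᵀ) = Matrix.trace X := by
      intro X
      rw [Matrix.trace_mul_comm, ← Matrix.mul_assoc, hU', Matrix.one_mul]
    rwa [h1, hAL, h2, h2] at h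
  have hcol : ∀ i, ∑ j, (W j i - (1 : Matrix (Fin n) (Fin n) ℝ) j i) ^ 2 = 2 - 2 * W i i := by
    intro i
    have h1 : ∑ j, W j i * W j i = 1 := by
      have := congrFun (congrFun hWW i) i
      simpa [Matrix.mul_apply] using this
    have h2 : ∀ j, (W j i - (1 : Matrix (Fin n) (Fin n) ℝ) j i) ^ 2
        = W j i * W j i + (if j = i then 1 - 2 * W j i else 0) := by
      intro j
      rw [Matrix.one_apply]
      split_ifs <;> ring
    simp only [h2, Finset.sum_add_distrib, h1, Finset.sum_ite_eq', Finset.mem_univ, if_true]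
    ring
  have hle : ∀ i, 0 ≤ 2 - 2 * W i i := by
    intro i
    rw [← hcol i]
    exact Finset.sum_nonneg fun j _ => sq_nonneg _
  have hnn : ∀ i ∈ Finset.univ, 0 ≤ D i i * (2 - 2 * W i i) :=
    fun i _ => mul_nonneg (hDnonneg i) (hle i)
  have hsum : ∑ i, D i i * (2 - 2 * W i i) = 0 := by
    apply le_antisymm _ (Finset.sum_nonneg hnn)
    simp only [Matrix.trace, Matrix.diag_apply, hentry] at htr
    have : ∑ i, D i i * (2 - 2 * W i i) = 2 * ∑ i, D i i - 2 * ∑ i, D i i * W i i := by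
      rw [Finset.mul_sum, Finset.mul_sum, ← Finset.sum_sub_distrib]
      exact Finset.sum_congr rfl fun i _ => by ring
    linarith
  have hDW : D * Wᵀ = D := by
    ext i j
    rw [hentry]
    have h0 := (Finset.sum_eq_zero_iff_of_nonneg hnn).mp hsum i (Finset.mem_univ i)
    rcases mul_eq_zero.mp h0 with h | h
    · by_cases hij : i = j
      · subst hij; rw [h, zero_mul]
      · rw [h, hDdiag i j hij, zero_mul]
    · rw [← hcol i] at h
      have h3 := (Finset.sum_eq_zero_iff_of_nonneg (fun j _ => sq_nonneg _)).mp h j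
        (Finset.mem_univ j)
      have h4 : W j i = (1 : Matrix (Fin n) (Fin n) ℝ) j i := sub_eq_zero.mp (pow_eq_zero_iff two_ne_zero |>.mp h3)
      rw [h4]
      by_cases hij : i = j
      · subst hij; simp
      · rw [hDdiag i j hij, Matrix.one_apply_ne (Ne.symm hij), mul_zero]
  have hDt : Dᵀ = D := by
    rw [hDd, Matrix.diagonal_transpose]
  rw [hAL, hDW]
  simp only [transpose_mul, transpose_transpose, hDt, Matrix.mul_assoc]
end

section
/- Let A be a real n×n matrix and L₀ an orthogonal matrix such that S = A * L₀ᵀ is symmetric positive semidefinite. Then L₀ is a global maximizer: for every orthogonal matrix L, trace(A * Lᵀ) ≤ trace(A * L₀ᵀ). -/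
open Matrix

/-- If `L₀` is an orthogonal matrix such that `S = A * L₀ᵀ` is
symmetric positive semidefinite, then `L₀` is a global maximizer of `trace (A * Lᵀ)`
over the orthogonal matrices. -/
theorem psd_stationary_point_is_maximizer
    (n : ℕ) (A L₀ : Matrix (Fin n) (Fin n) ℝ)
    (hL₀ : L₀ * L₀ᵀ = 1)
    (hsym : (A * L₀ᵀ)ᵀ = A * L₀ᵀ)
    (hpsd : ∀ x : Fin n → ℝ, 0 ≤ x ⬝ᵥ (A * L₀ᵀ).mulVec x) :
    ∀ L : Matrix (Fin n) (Fin n) ℝ, L * Lᵀ = 1 →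
      Matrix.trace (A * Lᵀ) ≤ Matrix.trace (A * L₀ᵀ) := by
  intro L hL
  have hL₀' : L₀ᵀ * L₀ = 1 := mul_eq_one_comm.mp hL₀
  obtain ⟨S, hS⟩ : ∃ S, S = A * L₀ᵀ := ⟨_, rfl⟩
  have hA : A = S * L₀ := by rw [hS, Matrix.mul_assoc, hL₀', Matrix.mul_one]
  rw [← hS] at hsym hpsd ⊢
  have h1 : 0 ≤ trace ((L₀ - L)ᵀ * (S * (L₀ - L))) := by
    apply Finset.sum_nonneg
    intro j _
    exact hpsd (fun i => (L₀ - L) i j)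
  have h2 : trace (S * (L * L₀ᵀ)) = trace (S * (L₀ * Lᵀ)) := by
    rw [← trace_transpose, transpose_mul, transpose_mul, transpose_transpose, hsym, trace_mul_comm]
  have h3 : trace ((L₀ - L)ᵀ * (S * (L₀ - L)))
      = 2 * trace S - 2 * trace (S * (L₀ * Lᵀ)) := by
    have h4 : (L₀ - L) * (L₀ - L)ᵀ = 1 - L₀ * Lᵀ - L * L₀ᵀ + 1 := by
      rw [transpose_sub, Matrix.sub_mul, Matrix.mul_sub, Matrix.mul_sub, hL₀, hL]
      abel
    rw [trace_mul_comm, Matrix.mul_assoc, h4, Matrix.mul_add, Matrix.mul_sub, Matrix.mul_sub,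
      trace_add, trace_sub, trace_sub, h2, Matrix.mul_one]
    ring
  rw [hA, Matrix.mul_assoc]
  linarith
end

section
/- Let m ≤ n and let A be a real m×n matrix admitting a singular value decomposition A = U * D * Vᵀ, where U is an m×m orthogonal matrix, V is an n×n orthogonal matrix, and D is an m×n matrix with D i j = 0 whenever (i : ℕ) ≠ (j : ℕ) and D i i ≥ 0 for all i. Then for every m×n real matrix L with L * Lᵀ = 1 (an m×m identity), trace(A * Lᵀ) ≤ Σᵢ D i i; moreover equality is attained at L = A' where A' = U * E * Vᵀ and E is the m×n matrix with E i j = 1 if (i : ℕ) = (j : ℕ) and 0 otherwise. -/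
open Matrix

/-- (Rectangular version of Theorem 2.) Let `m ≤ n` and let
`A = U * D * Vᵀ` be a singular value decomposition of the real `m × n` matrix `A`, where
`U` is `m × m` orthogonal, `V` is `n × n` orthogonal, and `D` is `m × n` with zero
off-diagonal entries and nonnegative diagonal entries. Then for every `m × n` real matrix
`L` with `L * Lᵀ = 1`, `trace (A * Lᵀ) ≤ Σᵢ D i i`, and equality is attained at
`L = U * E * Vᵀ` where `E i j = 1` if `(i : ℕ) = (j : ℕ)` and `0` otherwise. -/
theorem rectangular_svd_trace_le_sum_singular_values
    (m n : ℕ) (hmn : m ≤ n)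
    (A : Matrix (Fin m) (Fin n) ℝ)
    (U : Matrix (Fin m) (Fin m) ℝ) (V : Matrix (Fin n) (Fin n) ℝ)
    (D : Matrix (Fin m) (Fin n) ℝ)
    (hU : U * Uᵀ = 1) (hV : V * Vᵀ = 1)
    (hDdiag : ∀ (i : Fin m) (j : Fin n), (i : ℕ) ≠ (j : ℕ) → D i j = 0)
    (hDnonneg : ∀ i : Fin m, 0 ≤ D i (Fin.castLE hmn i))
    (hA : A = U * D * Vᵀ)
    (E : Matrix (Fin m) (Fin n) ℝ)
    (hE : ∀ (i : Fin m) (j : Fin n), E i j = if (i : ℕ) = (j : ℕ) then 1 else 0) :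
    (∀ L : Matrix (Fin m) (Fin n) ℝ, L * Lᵀ = 1 →
        Matrix.trace (A * Lᵀ) ≤ ∑ i : Fin m, D i (Fin.castLE hmn i)) ∧
      (U * E * Vᵀ) * (U * E * Vᵀ)ᵀ = 1 ∧
      Matrix.trace (A * (U * E * Vᵀ)ᵀ) = ∑ i : Fin m, D i (Fin.castLE hmn i) := by
  have hU' : Uᵀ * U = 1 := mul_eq_one_comm.mp hU
  have hV' : Vᵀ * V = 1 := mul_eq_one_comm.mp hV
  have hrow : ∀ (X : Matrix (Fin m) (Fin n) ℝ),
      (∀ (i : Fin m) (j : Fin n), (i : ℕ) ≠ (j : ℕ) → X i j = 0) →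
      ∀ (M : Matrix (Fin m) (Fin n) ℝ) (i k : Fin m),
        (X * Mᵀ) i k = X i (Fin.castLE hmn i) * M k (Fin.castLE hmn i) := by
    intro X hX M i k
    rw [Matrix.mul_apply]
    refine (Finset.sum_eq_single (Fin.castLE hmn i) ?_ ?_).trans ?_
    · intro j _ hj
      rw [hX i j, zero_mul]
      intro h
      exact hj (Fin.ext h.symm)
    · intro h
      exact absurd (Finset.mem_univ _) h
    · rfl
  have hkey : ∀ M : Matrix (Fin m) (Fin n) ℝ, Matrix.trace (D * Mᵀ)
      = ∑ i : Fin m, D i (Fin.castLE hmn i) * M i (Fin.castLE hmn i) := by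
    intro M
    exact Finset.sum_congr rfl fun i _ => hrow D hDdiag M i i
  have htr : ∀ L : Matrix (Fin m) (Fin n) ℝ,
      Matrix.trace (A * Lᵀ) = Matrix.trace (D * (Uᵀ * L * V)ᵀ) := by
    intro L
    rw [hA, Matrix.mul_assoc, Matrix.mul_assoc, Matrix.trace_mul_comm]
    simp only [Matrix.transpose_mul, Matrix.transpose_transpose, Matrix.mul_assoc]
  have hEE : E * Eᵀ = 1 := by
    ext i k
    rw [hrow E (fun i j h => by rw [hE, if_neg h]), hE, hE, Matrix.one_apply]
    simp [Fin.ext_iff, eq_comm]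
  refine ⟨?_, ?_, ?_⟩
  · intro L hL
    rw [htr, hkey]
    have hM : (Uᵀ * L * V) * (Uᵀ * L * V)ᵀ = 1 := by
      calc (Uᵀ * L * V) * (Uᵀ * L * V)ᵀ = Uᵀ * (L * (V * Vᵀ) * Lᵀ) * U := by
            simp only [Matrix.transpose_mul, Matrix.transpose_transpose, Matrix.mul_assoc]
        _ = 1 := by rw [hV, Matrix.mul_one, hL, Matrix.mul_one, hU']
    generalize Uᵀ * L * V = M at hM
    refine Finset.sum_le_sum fun i _ => ?_
    refine mul_le_of_le_one_right (hDnonneg i) ?_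
    have h1 : ∑ j, M i j * M i j = 1 := by
      have := congrFun (congrFun hM i) i
      rwa [Matrix.mul_apply, Matrix.one_apply_eq] at this
    have h2 : M i (Fin.castLE hmn i) * M i (Fin.castLE hmn i) ≤ ∑ j, M i j * M i j :=
      Finset.single_le_sum (f := fun j => M i j * M i j)
        (fun j _ => mul_self_nonneg _) (Finset.mem_univ _)
    nlinarith
  · calc (U * E * Vᵀ) * (U * E * Vᵀ)ᵀ = U * (E * (Vᵀ * V) * Eᵀ) * Uᵀ := by
          simp only [Matrix.transpose_mul, Matrix.transpose_transpose, Matrix.mul_assoc]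
      _ = 1 := by rw [hV', Matrix.mul_one, hEE, Matrix.mul_one, hU]
  · have h : Uᵀ * (U * E * Vᵀ) * V = E := by
      calc Uᵀ * (U * E * Vᵀ) * V = (Uᵀ * U) * E * (Vᵀ * V) := by
            simp only [Matrix.mul_assoc]
        _ = E := by rw [hU', hV', Matrix.one_mul, Matrix.mul_one]
    rw [htr, h, hkey]
    refine Finset.sum_congr rfl fun i _ => ?_
    rw [hE]
    simp
end

section
/- Let K be a finite nonempty type of categories, N ≥ 1, and x : Fin N → K a sample of N categorical observations. Suppose v : K → (Fin d → ℝ) is an embedding of the categories such that ⟨v k − v k', v k − v k'⟩ = 1 for all k ≠ k' (the categories are placed at the vertices of a regular simplex with unit edge length). Then (1/(2N²)) Σₐ Σ_b ⟨v (x a) − v (x b), v (x a) − v (x b)⟩ = (1/2) · (1 − Σ_{k ∈ K} (N_k / N)²), where N_k = |{a : Fin N | x a = k}| is the number of observations in category k. -/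
open Matrix

/-- Let `K` be a finite nonempty type of categories, `x : Fin N → K` a
sample of `N ≥ 1` categorical observations, and `v : K → (Fin d → ℝ)` an embedding
placing the categories at the vertices of a regular simplex with unit edge length
(`⟨v k − v k', v k − v k'⟩ = 1` for `k ≠ k'`). Then Gini's variance
`(1/(2N²)) Σₐ Σ_b ‖v (x a) − v (x b)‖²` equals `(1/2) · (1 − Σ_k (N_k/N)²)`, where
`N_k` is the number of observations in category `k`. -/
theorem gini_variance_regular_simplex
    (K : Type*) [Fintype K] [Nonempty K] [DecidableEq K]
    (N d : ℕ) (hN : 1 ≤ N)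
    (x : Fin N → K) (v : K → (Fin d → ℝ))
    (hv : ∀ k k' : K, k ≠ k' → (v k - v k') ⬝ᵥ (v k - v k') = 1) :
    (1 / (2 * (N : ℝ) ^ 2)) *
        ∑ a : Fin N, ∑ b : Fin N,
          (v (x a) - v (x b)) ⬝ᵥ (v (x a) - v (x b)) =
      (1 / 2) * (1 - ∑ k : K,
        ((((Finset.univ.filter fun a : Fin N => x a = k).card : ℝ) / (N : ℝ)) ^ 2)) := by
  have h1 : ∀ a b : Fin N, (v (x a) - v (x b)) ⬝ᵥ (v (x a) - v (x b))
      = 1 - ∑ k : K, (if x a = k then (1 : ℝ) else 0) * (if x b = k then (1 : ℝ) else 0) := by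
    intro a b
    have h2 : ∑ k : K, (if x a = k then (1 : ℝ) else 0) * (if x b = k then (1 : ℝ) else 0)
        = if x b = x a then 1 else 0 := by
      simp only [ite_mul, one_mul, zero_mul, Finset.sum_ite_eq, Finset.mem_univ, if_true]
    rw [h2]
    by_cases h : x b = x a
    · simp [h]
    · rw [hv _ _ (fun e => h e.symm), if_neg h, sub_zero]
  have h3 : ∑ a : Fin N, ∑ b : Fin N, (v (x a) - v (x b)) ⬝ᵥ (v (x a) - v (x b))
      = (N : ℝ) ^ 2 - ∑ k : K,
        ((Finset.univ.filter fun a : Fin N => x a = k).card : ℝ) ^ 2 := by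
    simp only [h1, Finset.sum_sub_distrib]
    congr 1
    · simp [sq]
    · have h4 : ∀ k : K, ((Finset.univ.filter fun a : Fin N => x a = k).card : ℝ) ^ 2
          = ∑ a : Fin N, ∑ b : Fin N,
            (if x a = k then (1 : ℝ) else 0) * (if x b = k then (1 : ℝ) else 0) := by
        intro k
        rw [← Finset.sum_mul_sum, Finset.sum_boole, sq]
      simp only [h4]
      conv_rhs => rw [Finset.sum_comm]
      refine Finset.sum_congr rfl fun a _ => ?_
      rw [Finset.sum_comm]
  have hN' : (N : ℝ) ≠ 0 := by
    have : N ≠ 0 := by omega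
    exact_mod_cast this
  rw [h3]
  simp only [div_pow]
  rw [← Finset.sum_div]
  field_simp
end
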